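/- Assume that for Lebesgue-a.e. x ∈ ℝ^n, 0 < ∫_0^∞ σ^{−n−2} f(x/σ) dσ < ∞ and ∫_0^∞ σ^{−n−1} f(x/σ) dσ < ∞, and that R₀ := ∫_{ℝ^n} (σ̂₀(x) − log σ̂₀(x) − 1) f(x) dx < ∞, where σ̂₀(x) = (∫_0^∞ σ^{−n−1} f(x/σ) dσ)/(∫_0^∞ σ^{−n−2} f(x/σ) dσ). For each k ≥ 1 let π_k(σ) = (1/(kσ)) φ((log σ)/k) for σ > 0, let δ_k(x) = (∫_0^∞ σ^{−n} f(x/σ) π_k(σ) dσ)/(∫_0^∞ σ^{−n−1} f(x/σ) π_k(σ) dσ) be the Bayes estimator under entropy loss, and let r_k = ∫_{ℝ^n} ∫_0^∞ L(δ_k(x)/σ) σ^{−n} f(x/σ) π_k(σ) dσ dx be its Bayes risk. Then lim_{k→∞} r_k = R₀. -/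

import Mathlib

open MeasureTheory ENNReal Filter Topology

/-- The standard normal density. -/
noncomputable def stdNormal (t : ℝ) : ℝ :=
  Real.exp (-(t ^ 2) / 2) / Real.sqrt (2 * Real.pi)

/-- The density of `σ` when `log σ ∼ N(0, k²)`. -/
noncomputable def logGaussPrior (k σ : ℝ) : ℝ := stdNormal (Real.log σ / k) / (k * σ)

/-- The Pitman scale estimator. -/
noncomputable def pitmanScale (n : ℕ) (f : (Fin n → ℝ) → ℝ) (x : Fin n → ℝ) : ℝ :=
  (∫ σ in Set.Ioi (0 : ℝ), σ ^ (-(n : ℤ) - 1) * f (fun i => x i / σ)) /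
    (∫ σ in Set.Ioi (0 : ℝ), σ ^ (-(n : ℤ) - 2) * f (fun i => x i / σ))

/-- The Bayes estimator under entropy loss for the prior `logGaussPrior k`. -/
noncomputable def bayesScale (n : ℕ) (f : (Fin n → ℝ) → ℝ) (k : ℝ) (x : Fin n → ℝ) : ℝ :=
  (∫ σ in Set.Ioi (0 : ℝ), σ ^ (-(n : ℤ)) * f (fun i => x i / σ) * logGaussPrior k σ) /
    (∫ σ in Set.Ioi (0 : ℝ), σ ^ (-(n : ℤ) - 1) * f (fun i => x i / σ) * logGaussPrior k σ)

lemma continuous_stdNormal : Continuous stdNormal := by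
  unfold stdNormal; fun_prop

lemma stdNormal_pos (t : ℝ) : 0 < stdNormal t := by
  unfold stdNormal; positivity

lemma stdNormal_le_one (t : ℝ) : stdNormal t ≤ 1 := by
  unfold stdNormal
  rw [div_le_one (by positivity)]
  calc Real.exp (-(t ^ 2) / 2) ≤ 1 := Real.exp_le_one_iff.2 (by nlinarith [sq_nonneg t])
    _ ≤ Real.sqrt (2 * Real.pi) := Real.one_le_sqrt.2 (by linarith [Real.pi_gt_three])

lemma lintegral_stdNormal : ∫⁻ z, ENNReal.ofReal (stdNormal z) = 1 := by
  rw [← ProbabilityTheory.lintegral_gaussianPDFReal_eq_one 0 one_ne_zero]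
  congr with z
  simp [stdNormal, ProbabilityTheory.gaussianPDFReal, div_eq_inv_mul]

lemma measurable_logGaussPrior (k : ℝ) : Measurable (logGaussPrior k) := by
  have := continuous_stdNormal.measurable
  unfold logGaussPrior; fun_prop

lemma logGaussPrior_pos {k σ : ℝ} (hk : 0 < k) (hσ : 0 < σ) : 0 < logGaussPrior k σ :=
  div_pos (stdNormal_pos _) (mul_pos hk hσ)

lemma logGaussPrior_exp_mul {k t : ℝ} (hk : 0 < k) (ht : 0 < t) (z : ℝ) :
    logGaussPrior k (Real.exp (k * z) * t) =
      (k * Real.exp (k * z))⁻¹ * (t⁻¹ * stdNormal (z + Real.log t / k)) := by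
  unfold logGaussPrior
  rw [Real.log_mul (Real.exp_pos _).ne' ht.ne', Real.log_exp, add_div,
    mul_div_cancel_left₀ _ hk.ne']
  field_simp

lemma lintegral_logGaussPrior_mul {k : ℝ} (hk : 0 < k) (G : ℝ → ℝ≥0∞) :
    ∫⁻ σ in Set.Ioi (0 : ℝ), ENNReal.ofReal (logGaussPrior k σ) * G σ =
      ∫⁻ z, ENNReal.ofReal (stdNormal z) * G (Real.exp (k * z)) := by
  have himage : (fun z => Real.exp (k * z)) '' Set.univ = Set.Ioi 0 := by
    ext s
    simp only [Set.image_univ, Set.mem_range, Set.mem_Ioi]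
    refine ⟨?_, fun hs => ⟨Real.log s / k, ?_⟩⟩
    · rintro ⟨z, rfl⟩
      exact Real.exp_pos _
    · rw [mul_div_cancel₀ _ hk.ne', Real.exp_log hs]
  have hderiv (z : ℝ) : HasDerivAt (fun z => Real.exp (k * z)) (Real.exp (k * z) * k) z := by
    simpa using ((hasDerivAt_id z).const_mul k).exp
  rw [← himage, lintegral_image_eq_lintegral_abs_deriv_mul MeasurableSet.univ
    (fun z _ => (hderiv z).hasDerivWithinAt), setLIntegral_univ]
  · refine lintegral_congr fun z => ?_
    rw [← mul_assoc, ← ENNReal.ofReal_mul (abs_nonneg _), abs_of_pos (by positivity)]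
    congr 2
    have h := logGaussPrior_exp_mul hk one_pos z
    simp only [mul_one, inv_one, one_mul, Real.log_one, zero_div, add_zero] at h
    rw [h]
    field_simp
  · intro a _ b _ hab
    exact mul_left_cancel₀ hk.ne' (Real.exp_injective hab)

/-- If `F` has positive integral and `G` is positive wherever `F` is, then `G` has positive
integral. -/
lemma setIntegral_pos_of_pos_imp_pos {F G : ℝ → ℝ} {s : Set ℝ} (hs : MeasurableSet s)
    (hF0 : ∀ σ ∈ s, 0 ≤ F σ) (hG0 : ∀ σ ∈ s, 0 ≤ G σ) (hFG : ∀ σ ∈ s, 0 < F σ → 0 < G σ)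
    (hG : IntegrableOn G s) (hF : 0 < ∫ σ in s, F σ) : 0 < ∫ σ in s, G σ := by
  have hFi : IntegrableOn F s := by
    by_contra h
    rw [integral_undef h] at hF
    exact hF.false
  rw [setIntegral_pos_iff_support_of_nonneg_ae (ae_restrict_of_forall_mem hs hF0) hFi] at hF
  rw [setIntegral_pos_iff_support_of_nonneg_ae (ae_restrict_of_forall_mem hs hG0) hG]
  refine hF.trans_le (measure_mono ?_)
  rintro σ ⟨h, hσ⟩
  exact ⟨(hFG σ hσ ((hF0 σ hσ).lt_of_ne' h)).ne', hσ⟩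

lemma sub_log_sub_one_nonneg {t : ℝ} (ht : 0 < t) : 0 ≤ t - Real.log t - 1 := by
  linarith [Real.log_le_sub_one_of_pos ht]

/-- The ratio `∫ w / ∫ (w / σ)` minimises the posterior expected entropy loss for the weight
`w`. -/
lemma lintegral_entropyLoss_ratio_le {w v : ℝ → ℝ} (hw0 : ∀ σ ∈ Set.Ioi (0 : ℝ), 0 ≤ w σ)
    (hv : ∀ σ ∈ Set.Ioi (0 : ℝ), v σ = w σ / σ)
    (hw : IntegrableOn w (Set.Ioi 0)) (hvi : IntegrableOn v (Set.Ioi 0))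
    (hA : 0 < ∫ σ in Set.Ioi (0 : ℝ), w σ) (hB : 0 < ∫ σ in Set.Ioi (0 : ℝ), v σ)
    {δ d : ℝ} (hδ : δ = (∫ σ in Set.Ioi (0 : ℝ), w σ) / ∫ σ in Set.Ioi (0 : ℝ), v σ)
    (hd : 0 < d) :
    ∫⁻ σ in Set.Ioi (0 : ℝ), ENNReal.ofReal ((δ / σ - Real.log (δ / σ) - 1) * w σ) ≤
      ∫⁻ σ in Set.Ioi (0 : ℝ), ENNReal.ofReal ((d / σ - Real.log (d / σ) - 1) * w σ) := by
  set A := ∫ σ in Set.Ioi (0 : ℝ), w σ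
  set B := ∫ σ in Set.Ioi (0 : ℝ), v σ
  have hδ0 : 0 < δ := hδ ▸ div_pos hA hB
  rcases eq_or_ne (∫⁻ σ in Set.Ioi (0 : ℝ),
    ENNReal.ofReal ((d / σ - Real.log (d / σ) - 1) * w σ)) ⊤ with htop | hfin
  · rw [htop]; exact le_top
  have hnonneg {c : ℝ} (hc : 0 < c) : 0 ≤ᵐ[volume.restrict (Set.Ioi (0 : ℝ))]
      fun σ => (c / σ - Real.log (c / σ) - 1) * w σ :=
    ae_restrict_of_forall_mem measurableSet_Ioi fun σ hσ =>
      mul_nonneg (sub_log_sub_one_nonneg (div_pos hc hσ)) (hw0 σ hσ)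
  have hd_int : IntegrableOn (fun σ => (d / σ - Real.log (d / σ) - 1) * w σ) (Set.Ioi 0) := by
    refine (lintegral_ofReal_ne_top_iff_integrable ?_ (hnonneg hd)).1 hfin
    refine AEStronglyMeasurable.mul ?_ hw.aestronglyMeasurable
    exact Measurable.aestronglyMeasurable (by fun_prop)
  have hcorr : IntegrableOn (fun σ => (δ - d) * v σ - Real.log (δ / d) * w σ) (Set.Ioi 0) :=
    (hvi.const_mul _).sub (hw.const_mul _)
  have heq : (fun σ => (δ / σ - Real.log (δ / σ) - 1) * w σ)
      =ᵐ[volume.restrict (Set.Ioi (0 : ℝ))]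
      fun σ => (d / σ - Real.log (d / σ) - 1) * w σ +
        ((δ - d) * v σ - Real.log (δ / d) * w σ) := by
    refine ae_restrict_of_forall_mem measurableSet_Ioi fun σ hσ => ?_
    have hσ0 : σ ≠ 0 := (Set.mem_Ioi.1 hσ).ne'
    simp only
    rw [hv σ hσ, Real.log_div hδ0.ne' hσ0, Real.log_div hd.ne' hσ0, Real.log_div hδ0.ne' hd.ne']
    ring
  rw [← ofReal_integral_eq_lintegral_ofReal ((hd_int.add hcorr).congr heq.symm) (hnonneg hδ0),
    ← ofReal_integral_eq_lintegral_ofReal hd_int (hnonneg hd)]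
  refine ENNReal.ofReal_le_ofReal ?_
  rw [integral_congr_ae heq, integral_add hd_int hcorr,
    integral_sub (hvi.const_mul _) (hw.const_mul _), integral_const_mul, integral_const_mul]
  have hAB : A = δ * B := by rw [hδ]; field_simp
  have hlog := Real.log_le_sub_one_of_pos (div_pos hd hδ0)
  rw [Real.log_div hd.ne' hδ0.ne'] at hlog
  have hmul := mul_le_mul_of_nonneg_right hlog hA.le
  have hdA : (d / δ - 1) * A = (d - δ) * B := by rw [hAB]; field_simp
  rw [hdA] at hmul
  change _ + ((δ - d) * B - Real.log (δ / d) * A) ≤ _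
  rw [Real.log_div hδ0.ne' hd.ne']
  linarith

section Scaling

variable {n : ℕ}

lemma setIntegral_zpow_mul_comp_smul_div (f : (Fin n → ℝ) → ℝ) (h : ℝ → ℝ) (j : ℤ) {c : ℝ}
    (hc : 0 < c) (x : Fin n → ℝ) :
    ∫ σ in Set.Ioi (0 : ℝ), σ ^ j * f (fun i => (c • x) i / σ) * h σ =
      c ^ (j + 1) * ∫ t in Set.Ioi (0 : ℝ), t ^ j * f (fun i => x i / t) * h (c * t) := by
  have hchange := integral_comp_mul_left_Ioi'
    (fun σ => σ ^ j * f (fun i => (c • x) i / σ) * h σ) 0 hc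
  rw [mul_zero] at hchange
  rw [← hchange, smul_eq_mul, zpow_add_one₀ hc.ne', mul_comm (c ^ j) c, mul_assoc,
    ← integral_const_mul (c ^ j)]
  congr 2 with t
  simp only [Pi.smul_apply, smul_eq_mul, mul_div_mul_left _ _ hc.ne', mul_zpow]
  ring

lemma pitmanScale_smul (f : (Fin n → ℝ) → ℝ) {c : ℝ} (hc : 0 < c) (x : Fin n → ℝ) :
    pitmanScale n f (c • x) = c * pitmanScale n f x := by
  have h1 := setIntegral_zpow_mul_comp_smul_div f (fun _ => 1) (-(n : ℤ) - 1) hc x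
  have h2 := setIntegral_zpow_mul_comp_smul_div f (fun _ => 1) (-(n : ℤ) - 2) hc x
  simp only [mul_one] at h1 h2
  unfold pitmanScale
  rw [h1, h2, show (-(n : ℤ) - 1 + 1) = (-(n : ℤ) - 2 + 1) + 1 by ring, zpow_add_one₀ hc.ne',
    mul_div_mul_comm, mul_div_cancel_left₀ _ (zpow_ne_zero _ hc.ne')]

lemma bayesScale_exp_smul_div (f : (Fin n → ℝ) → ℝ) {k : ℝ} (hk : 0 < k) (z : ℝ)
    (y : Fin n → ℝ) :
    bayesScale n f k (Real.exp (k * z) • y) / Real.exp (k * z) =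
      (∫ t in Set.Ioi (0 : ℝ), t ^ (-(n : ℤ) - 1) * f (fun i => y i / t) *
          stdNormal (z + Real.log t / k)) /
        (∫ t in Set.Ioi (0 : ℝ), t ^ (-(n : ℤ) - 2) * f (fun i => y i / t) *
          stdNormal (z + Real.log t / k)) := by
  set c := Real.exp (k * z) with hcdef
  have hc : 0 < c := Real.exp_pos _
  have key (j : ℤ) :
      ∫ t in Set.Ioi (0 : ℝ), t ^ j * f (fun i => y i / t) * logGaussPrior k (c * t) =
        (k * c)⁻¹ * ∫ t in Set.Ioi (0 : ℝ), t ^ (j - 1) * f (fun i => y i / t) *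
          stdNormal (z + Real.log t / k) := by
    rw [← integral_const_mul]
    refine setIntegral_congr_fun measurableSet_Ioi fun t ht => ?_
    rw [logGaussPrior_exp_mul hk ht, zpow_sub_one₀ (Set.mem_Ioi.1 ht).ne']
    ring
  have hkc : (k * c)⁻¹ ≠ 0 := by positivity
  unfold bayesScale
  rw [setIntegral_zpow_mul_comp_smul_div f _ _ hc, setIntegral_zpow_mul_comp_smul_div f _ _ hc,
    key, key, zpow_add_one₀ hc.ne', sub_add_cancel, sub_sub, one_add_one_eq_two,
    mul_div_mul_comm, mul_div_mul_left _ _ hkc,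
    mul_div_cancel_left₀ _ (zpow_ne_zero _ hc.ne'), mul_div_cancel_left₀ _ hc.ne']

lemma measurable_setIntegral_zpow_mul {f : (Fin n → ℝ) → ℝ} (hf : Measurable f) {h : ℝ → ℝ}
    (hh : Measurable h) (j : ℤ) :
    Measurable fun x : Fin n → ℝ =>
      ∫ σ in Set.Ioi (0 : ℝ), σ ^ j * f (fun i => x i / σ) * h σ := by
  refine (StronglyMeasurable.integral_prod_right
    (f := fun (x : Fin n → ℝ) (σ : ℝ) => σ ^ j * f (fun i => x i / σ) * h σ) ?_).measurable
  apply Measurable.stronglyMeasurable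
  unfold Function.uncurry
  fun_prop

lemma measurable_bayesScale {f : (Fin n → ℝ) → ℝ} (hf : Measurable f) (k : ℝ) :
    Measurable (bayesScale n f k) :=
  (measurable_setIntegral_zpow_mul hf (measurable_logGaussPrior k) _).div
    (measurable_setIntegral_zpow_mul hf (measurable_logGaussPrior k) _)

lemma measurable_pitmanScale {f : (Fin n → ℝ) → ℝ} (hf : Measurable f) :
    Measurable (pitmanScale n f) := by
  have h (j : ℤ) := measurable_setIntegral_zpow_mul hf (measurable_const (a := (1 : ℝ))) j
  simp only [mul_one] at h
  exact (h _).div (h _)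

lemma lintegral_eq_mul_lintegral_smul {G : (Fin n → ℝ) → ℝ≥0∞} (hG : Measurable G) {c : ℝ}
    (hc : 0 < c) : ∫⁻ x, G x = ENNReal.ofReal (c ^ n) * ∫⁻ y, G (c • y) := by
  have hmap := lintegral_map (μ := volume) hG (measurable_const_smul c)
  rw [Measure.map_addHaar_smul _ hc.ne', lintegral_smul_measure, Module.finrank_fin_fun,
    smul_eq_mul, abs_of_pos (by positivity)] at hmap
  rw [← hmap, ← mul_assoc, ← ENNReal.ofReal_mul (by positivity),
    mul_inv_cancel₀ (by positivity), ENNReal.ofReal_one, one_mul]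

/-- The integrated entropy risk of an estimator `δ`, in the coordinates `σ = exp (k z)`,
`x = σ y`. -/
lemma lintegral_entropyRisk_eq {f : (Fin n → ℝ) → ℝ} (hf : Measurable f)
    {δ : (Fin n → ℝ) → ℝ} (hδ : Measurable δ) {k : ℝ} (hk : 0 < k) :
    ∫⁻ x, ∫⁻ σ in Set.Ioi (0 : ℝ), ENNReal.ofReal
        ((δ x / σ - Real.log (δ x / σ) - 1) *
          (σ ^ (-(n : ℤ)) * f (fun i => x i / σ) * logGaussPrior k σ)) =
      ∫⁻ z, ∫⁻ y, ENNReal.ofReal (stdNormal z *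
        ((δ (Real.exp (k * z) • y) / Real.exp (k * z) -
          Real.log (δ (Real.exp (k * z) • y) / Real.exp (k * z)) - 1) * f y)) := by
  have hprior := measurable_logGaussPrior k
  rw [lintegral_lintegral_swap (by unfold Function.uncurry; fun_prop)]
  let G : ℝ → ℝ≥0∞ := fun σ => ∫⁻ y, ENNReal.ofReal
    ((δ (σ • y) / σ - Real.log (δ (σ • y) / σ) - 1) * f y)
  trans ∫⁻ σ in Set.Ioi (0 : ℝ), ENNReal.ofReal (logGaussPrior k σ) * G σ
  · refine setLIntegral_congr_fun measurableSet_Ioi fun σ hσ => ?_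
    have hσ0 : 0 < σ := hσ
    rw [lintegral_eq_mul_lintegral_smul (by fun_prop) hσ0,
      ← lintegral_const_mul _ (by fun_prop), ← lintegral_const_mul _ (by fun_prop)]
    refine lintegral_congr fun y => ?_
    rw [← ENNReal.ofReal_mul (by positivity),
      ← ENNReal.ofReal_mul (logGaussPrior_pos hk hσ0).le]
    congr 1
    simp only [Pi.smul_apply, smul_eq_mul, mul_div_cancel_left₀ _ hσ0.ne', zpow_neg, zpow_natCast]
    field_simp
  · rw [lintegral_logGaussPrior_mul hk]
    refine lintegral_congr fun z => ?_
    rw [← lintegral_const_mul _ (by fun_prop)]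
    refine lintegral_congr fun y => ?_
    rw [← ENNReal.ofReal_mul (stdNormal_pos z).le]

lemma tendsto_setIntegral_mul_stdNormal {g : ℝ → ℝ} (hg : IntegrableOn g (Set.Ioi 0)) (z : ℝ) :
    Tendsto (fun k : ℝ => ∫ t in Set.Ioi (0 : ℝ), g t * stdNormal (z + Real.log t / k)) atTop
      (𝓝 ((∫ t in Set.Ioi (0 : ℝ), g t) * stdNormal z)) := by
  rw [← integral_mul_const]
  have hmeas := continuous_stdNormal.measurable
  refine tendsto_integral_filter_of_dominated_convergence (fun t => ‖g t‖)
    (Eventually.of_forall fun k => ?_) (Eventually.of_forall fun k => ae_of_all _ fun t => ?_)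
    hg.norm (ae_of_all _ fun t => ?_)
  · refine hg.aestronglyMeasurable.mul ?_
    exact Measurable.aestronglyMeasurable (by fun_prop)
  · rw [norm_mul, Real.norm_of_nonneg (stdNormal_pos _).le]
    exact mul_le_of_le_one_right (norm_nonneg _) (stdNormal_le_one _)
  · refine tendsto_const_nhds.mul ((continuous_stdNormal.tendsto z).comp ?_)
    have hlog : Tendsto (fun k : ℝ => Real.log t / k) atTop (𝓝 0) :=
      tendsto_const_nhds.div_atTop tendsto_id
    simpa using hlog.const_add z

lemma tendsto_bayesScale_exp_smul_div {f : (Fin n → ℝ) → ℝ} {y : Fin n → ℝ}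
    (h2 : IntegrableOn (fun σ : ℝ => σ ^ (-(n : ℤ) - 2) * f (fun i => y i / σ)) (Set.Ioi 0))
    (hpos : 0 < ∫ σ in Set.Ioi (0 : ℝ), σ ^ (-(n : ℤ) - 2) * f (fun i => y i / σ))
    (h1 : IntegrableOn (fun σ : ℝ => σ ^ (-(n : ℤ) - 1) * f (fun i => y i / σ)) (Set.Ioi 0))
    (z : ℝ) :
    Tendsto (fun k : ℝ => bayesScale n f k (Real.exp (k * z) • y) / Real.exp (k * z)) atTop
      (𝓝 (pitmanScale n f y)) := by
  have hz := stdNormal_pos z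
  have hlim := (tendsto_setIntegral_mul_stdNormal h1 z).div
    (tendsto_setIntegral_mul_stdNormal h2 z) (mul_pos hpos hz).ne'
  rw [mul_div_mul_right _ _ hz.ne'] at hlim
  refine hlim.congr' ?_
  filter_upwards [eventually_gt_atTop 0] with k hk
  exact (bayesScale_exp_smul_div f hk z y).symm

lemma pitmanScale_pos {f : (Fin n → ℝ) → ℝ} (hf0 : ∀ x, 0 ≤ f x) {y : Fin n → ℝ}
    (hpos : 0 < ∫ σ in Set.Ioi (0 : ℝ), σ ^ (-(n : ℤ) - 2) * f (fun i => y i / σ))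
    (h1 : IntegrableOn (fun σ : ℝ => σ ^ (-(n : ℤ) - 1) * f (fun i => y i / σ)) (Set.Ioi 0)) :
    0 < pitmanScale n f y := by
  refine div_pos (setIntegral_pos_of_pos_imp_pos measurableSet_Ioi
    (fun σ hσ => ?_) (fun σ hσ => ?_) (fun σ hσ h => ?_) h1 hpos) hpos
  · exact mul_nonneg (zpow_pos hσ _).le (hf0 _)
  · exact mul_nonneg (zpow_pos hσ _).le (hf0 _)
  · exact mul_pos (zpow_pos hσ _) (pos_of_mul_pos_right h (zpow_pos hσ _).le)

lemma integrableOn_zpow_mul_logGaussPrior {f : (Fin n → ℝ) → ℝ} {x : Fin n → ℝ} {k : ℝ}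
    (hk : 0 < k) {j : ℤ}
    (h : IntegrableOn (fun σ : ℝ => σ ^ (j - 1) * f (fun i => x i / σ)) (Set.Ioi 0)) :
    IntegrableOn (fun σ : ℝ => σ ^ j * f (fun i => x i / σ) * logGaussPrior k σ)
      (Set.Ioi 0) := by
  have hmeas := continuous_stdNormal.measurable
  have hbdd := (Integrable.mul_bdd (c := 1) h
    (g := fun σ => stdNormal (Real.log σ / k))
    (Measurable.aestronglyMeasurable (by fun_prop)) (ae_of_all _ fun σ => by
      rw [Real.norm_of_nonneg (stdNormal_pos _).le]; exact stdNormal_le_one _)).const_mul k⁻¹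
  refine hbdd.congr (ae_restrict_of_forall_mem measurableSet_Ioi fun σ hσ => ?_)
  have hσ0 : σ ≠ 0 := (Set.mem_Ioi.1 hσ).ne'
  simp only [logGaussPrior]
  rw [zpow_sub_one₀ hσ0]
  field_simp

lemma lintegral_entropyLoss_bayesScale_le {f : (Fin n → ℝ) → ℝ} (hf0 : ∀ x, 0 ≤ f x)
    {x : Fin n → ℝ} {k d : ℝ} (hk : 0 < k) (hd : 0 < d)
    (h2 : IntegrableOn (fun σ : ℝ => σ ^ (-(n : ℤ) - 2) * f (fun i => x i / σ)) (Set.Ioi 0))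
    (hpos : 0 < ∫ σ in Set.Ioi (0 : ℝ), σ ^ (-(n : ℤ) - 2) * f (fun i => x i / σ))
    (h1 : IntegrableOn (fun σ : ℝ => σ ^ (-(n : ℤ) - 1) * f (fun i => x i / σ)) (Set.Ioi 0)) :
    ∫⁻ σ in Set.Ioi (0 : ℝ), ENNReal.ofReal
        ((bayesScale n f k x / σ - Real.log (bayesScale n f k x / σ) - 1) *
          (σ ^ (-(n : ℤ)) * f (fun i => x i / σ) * logGaussPrior k σ)) ≤
      ∫⁻ σ in Set.Ioi (0 : ℝ), ENNReal.ofReal ((d / σ - Real.log (d / σ) - 1) *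
          (σ ^ (-(n : ℤ)) * f (fun i => x i / σ) * logGaussPrior k σ)) := by
  have hw := integrableOn_zpow_mul_logGaussPrior hk h1
  have hv : IntegrableOn (fun σ : ℝ =>
      σ ^ (-(n : ℤ) - 1) * f (fun i => x i / σ) * logGaussPrior k σ) (Set.Ioi 0) :=
    integrableOn_zpow_mul_logGaussPrior hk (by rwa [sub_sub, one_add_one_eq_two])
  have hnonneg (j : ℤ) (σ : ℝ) (hσ : σ ∈ Set.Ioi (0 : ℝ)) :
      0 ≤ σ ^ j * f (fun i => x i / σ) * logGaussPrior k σ :=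
    mul_nonneg (mul_nonneg (zpow_pos hσ _).le (hf0 _)) (logGaussPrior_pos hk hσ).le
  have hint_pos (j : ℤ) (hj : IntegrableOn (fun σ : ℝ =>
      σ ^ j * f (fun i => x i / σ) * logGaussPrior k σ) (Set.Ioi 0)) :
      0 < ∫ σ in Set.Ioi (0 : ℝ), σ ^ j * f (fun i => x i / σ) * logGaussPrior k σ := by
    refine setIntegral_pos_of_pos_imp_pos measurableSet_Ioi (fun σ hσ => ?_) (hnonneg j)
      (fun σ hσ h => ?_) hj hpos
    · exact mul_nonneg (zpow_pos hσ _).le (hf0 _)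
    · exact mul_pos (mul_pos (zpow_pos hσ _) (pos_of_mul_pos_right h (zpow_pos hσ _).le))
        (logGaussPrior_pos hk hσ)
  refine lintegral_entropyLoss_ratio_le (hnonneg _) (fun σ hσ => ?_) hw hv (hint_pos _ hw)
    (hint_pos _ hv) rfl hd
  rw [zpow_sub_one₀ (Set.mem_Ioi.1 hσ).ne']
  ring

end Scaling

/-- The Bayes risks under the log-Gaussian priors converge, as `k → ∞`, to the
constant risk `R₀` of the Pitman scale estimator under entropy loss. -/
theorem scale_bayes_risk_tendsto
    (n : ℕ) (f : (Fin n → ℝ) → ℝ) (hfm : Measurable f) (hf0 : ∀ x, 0 ≤ f x)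
    (hf1 : ∫ x, f x = 1)
    (hae : ∀ᵐ x : Fin n → ℝ,
      IntegrableOn (fun σ : ℝ => σ ^ (-(n : ℤ) - 2) * f (fun i => x i / σ)) (Set.Ioi 0) ∧
      0 < (∫ σ in Set.Ioi (0 : ℝ), σ ^ (-(n : ℤ) - 2) * f (fun i => x i / σ)) ∧
      IntegrableOn (fun σ : ℝ => σ ^ (-(n : ℤ) - 1) * f (fun i => x i / σ)) (Set.Ioi 0))
    (R₀ : ℝ≥0∞)
    (hR₀ : R₀ = ∫⁻ x, ENNReal.ofReal
      ((pitmanScale n f x - Real.log (pitmanScale n f x) - 1) * f x))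
    (hR₀fin : R₀ < ⊤) :
    Tendsto (fun k : ℝ =>
        ∫⁻ x, ∫⁻ σ in Set.Ioi (0 : ℝ),
          ENNReal.ofReal
            ((bayesScale n f k x / σ - Real.log (bayesScale n f k x / σ) - 1) *
              (σ ^ (-(n : ℤ)) * f (fun i => x i / σ) * logGaussPrior k σ)))
      atTop (𝓝 R₀) := by
  have hprior_mul_risk :
      ∫⁻ z, ∫⁻ y, ENNReal.ofReal (stdNormal z *
        ((pitmanScale n f y - Real.log (pitmanScale n f y) - 1) * f y)) = R₀ := by
    have hpm := measurable_pitmanScale hfm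
    have hφ := continuous_stdNormal.measurable
    simp_rw [ENNReal.ofReal_mul (stdNormal_pos _).le]
    rw [← one_mul R₀, ← lintegral_stdNormal, hR₀, ← lintegral_mul_const _ (by fun_prop)]
    refine lintegral_congr fun z => ?_
    rw [lintegral_const_mul _ (by fun_prop)]
  refine tendsto_of_le_liminf_of_limsup_le ?_ ?_
  · rw [liminf_congr ((eventually_gt_atTop (0 : ℝ)).mono fun k hk =>
      lintegral_entropyRisk_eq hfm (measurable_bayesScale hfm k) hk), ← hprior_mul_risk]
    have hφ := continuous_stdNormal.measurable
    have hbm := measurable_bayesScale hfm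
    refine le_trans (lintegral_mono fun z => ?_) (lintegral_liminf_le fun k => ?_)
    · refine le_trans (lintegral_mono_ae ?_) (lintegral_liminf_le fun k => ?_)
      · filter_upwards [hae] with y ⟨h2, hpos, h1⟩
        have hlim := tendsto_bayesScale_exp_smul_div h2 hpos h1 z
        have hlog := hlim.log (pitmanScale_pos hf0 hpos h1).ne'
        exact (ENNReal.tendsto_ofReal ((((hlim.sub hlog).sub_const 1).mul_const (f y)).const_mul
          (stdNormal z))).liminf_eq.ge
      · have := hbm k
        fun_prop
    · have := hbm k
      refine Measurable.lintegral_prod_right ?_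
      unfold Function.uncurry
      fun_prop
  · refine limsup_le_of_le (h := ?_)
    filter_upwards [eventually_gt_atTop 0] with k hk
    refine (lintegral_mono_ae (hae.mono fun x hx => lintegral_entropyLoss_bayesScale_le hf0 hk
      (pitmanScale_pos hf0 hx.2.1 hx.2.2) hx.1 hx.2.1 hx.2.2)).trans_eq ?_
    rw [lintegral_entropyRisk_eq hfm (measurable_pitmanScale hfm) hk, ← hprior_mul_risk]
    simp_rw [pitmanScale_smul f (Real.exp_pos _), mul_div_cancel_left₀ _ (Real.exp_pos _).ne']
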